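/- Let p ∈ [0,1] satisfy θ(p) > 0 and let α > 0. There exists a constant κ > 0 (depending on α and p) such that for every integer n ≥ 2, the probability that every pair of vertices x, y of the box Λ(n) are joined by a path lying in Λ(n) having at most κ(ln n)² closed sites (equivalently: T_{Λ(n)}(x,y) ≤ κ(ln n)² for all x, y ∈ Λ(n)) is at least 1 − 1/n^α. -/

import Mathlib

open MeasureTheory ENNReal

noncomputable section

/-- A site of the lattice `ℤ³`. -/
abbrev Site := Fin 3 → ℤ

/-- A percolation configuration: `ω z = true` means that the site `z` is open,
`ω z = false` means that it is closed. -/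
abbrev Config := Site → Bool

/-- Two sites are neighbours when their Euclidean distance is `1`. -/
def Adj (x y : Site) : Prop := ∑ i, |x i - y i| = 1

/-- `γ` is a path from `x` to `y` staying inside `A`. -/
def IsPathIn (A : Set Site) (x y : Site) (γ : List Site) : Prop :=
  γ.Chain' Adj ∧ γ.head? = some x ∧ γ.getLast? = some y ∧ ∀ z ∈ γ, z ∈ A

/-- The number of closed sites along the path `γ`. -/
def pathCost (ω : Config) (γ : List Site) : ℕ := γ.countP fun z => !ω z

/-- The travel time `T_A(x,y)` between `x` and `y` inside `A`: the infimum of the number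
of closed sites over all paths from `x` to `y` in `A` (`⊤` if there is no such path). -/
def travelTime (ω : Config) (A : Set Site) (x y : Site) : ℝ≥0∞ :=
  sInf {c : ℝ≥0∞ | ∃ γ : List Site, IsPathIn A x y γ ∧ c = pathCost ω γ}

/-- The travel time `T_A(x,E)` between `x` and the set `E` inside `A`. -/
def travelTimeSet (ω : Config) (A : Set Site) (x : Site) (E : Set Site) : ℝ≥0∞ :=
  ⨅ y ∈ E, travelTime ω A x y

/-- The open cluster `C(x)` of the site `x` (empty when `x` is closed). -/
def cluster (ω : Config) (x : Site) : Set Site :=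
  {y | ∃ γ : List Site, IsPathIn {z | ω z = true} x y γ}

/-- The internal boundary `∂ⁱⁿA` of `A`. -/
def intBd (A : Set Site) : Set Site := {x | x ∈ A ∧ ∃ y ∉ A, Adj x y}

/-- The external boundary `∂ᵒᵘᵗA` of `A`. -/
def extBd (A : Set Site) : Set Site := {x | x ∉ A ∧ ∃ y ∈ A, Adj x y}

/-- `P` is the Bernoulli site percolation measure with parameter `p`: the sites are
independent and each one is open with probability `p`, closed with probability `1 - p`,
as expressed by the probabilities of the cylinder events. -/
def IsBernoulli (p : ℝ) (P : Measure Config) : Prop :=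
  ∀ (s : Finset Site) (f : Site → Bool),
    P {ω | ∀ z ∈ s, ω z = f z} =
      ∏ z ∈ s, (if f z then ENNReal.ofReal p else ENNReal.ofReal (1 - p))

/-- `θ(p)`: the probability that the open cluster of the origin is infinite. -/
def theta (P : Measure Config) : ℝ≥0∞ := P {ω | (cluster ω 0).Infinite}

/-- The box `Λ(r) = [-r, r]³ ∩ ℤ³`. -/
def box (r : ℝ) : Set Site := {z | ∀ i, |(z i : ℝ)| ≤ r}

/-! ### Walks with a cost -/

/-- The cost of a site. -/
def siteCost (ω : Config) (z : Site) : ℕ := if ω z then 0 else 1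

lemma siteCost_le (ω : Config) (z : Site) : siteCost ω z ≤ 1 := by
  unfold siteCost; split_ifs <;> simp

/-- `Reach A ω k x y`: some walk in `A` from `x` to `y` visits exactly `k` closed sites. -/
inductive Reach (A : Set Site) (ω : Config) : ℕ → Site → Site → Prop
  | refl (x : Site) (hx : x ∈ A) : Reach A ω (siteCost ω x) x x
  | step {k : ℕ} {x y : Site} (z : Site) (h : Reach A ω k x y) (hyz : Adj y z) (hz : z ∈ A) :
      Reach A ω (k + siteCost ω z) x z

/-- Reachability with cost at most `k`. -/
def RL (A : Set Site) (ω : Config) (k : ℕ) (x y : Site) : Prop := ∃ j ≤ k, Reach A ω j x y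

lemma Adj.symm' {x y : Site} (h : Adj x y) : Adj y x := by
  unfold Adj at *
  rw [← h]
  exact Finset.sum_congr rfl fun i _ => abs_sub_comm _ _

lemma Reach.right_mem {A : Set Site} {ω : Config} {k : ℕ} {x y : Site} (h : Reach A ω k x y) :
    y ∈ A := by
  cases h with
  | refl _ hx => exact hx
  | step _ _ _ hz => exact hz

lemma Reach.cost_right {A : Set Site} {ω : Config} {k : ℕ} {x y : Site} (h : Reach A ω k x y) :
    siteCost ω y ≤ k := by
  cases h with
  | refl _ hx => exact le_rfl
  | step _ _ _ hz => omega

lemma Reach.cons {A : Set Site} {ω : Config} {k : ℕ} {x y z : Site} (h : Reach A ω k y z)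
    (hxy : Adj x y) (hx : x ∈ A) : Reach A ω (k + siteCost ω x) x z := by
  induction h with
  | refl y hy =>
    rw [add_comm]
    exact Reach.step _ (Reach.refl x hx) hxy hy
  | step z' h hyz hz ih =>
    have := Reach.step z' (ih hxy) hyz hz
    convert this using 1
    omega

lemma Reach.symm {A : Set Site} {ω : Config} {k : ℕ} {x y : Site} (h : Reach A ω k x y) :
    Reach A ω k y x := by
  induction h with
  | refl x hx => exact Reach.refl x hx
  | step z h hyz hz ih => exact ih.cons hyz.symm' hz

lemma RL.trans {A : Set Site} {ω : Config} {k l : ℕ} {x y z : Site} (h : RL A ω k x y)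
    (h' : RL A ω l y z) : RL A ω (k + l) x z := by
  obtain ⟨j, hj, h⟩ := h
  obtain ⟨i, hi, h'⟩ := h'
  suffices H : ∃ m ≤ j + i, Reach A ω m x z by
    obtain ⟨m, hm, H⟩ := H
    exact ⟨m, by omega, H⟩
  clear hi hj
  induction h' with
  | refl y hy => exact ⟨j, by omega, h⟩
  | step z' _ hyz hz ih =>
    obtain ⟨m, hm, H⟩ := ih h
    exact ⟨_, by omega, Reach.step z' H hyz hz⟩

lemma RL.mono {A B : Set Site} {ω : Config} {k l : ℕ} {x y : Site} (h : RL A ω k x y)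
    (hAB : A ⊆ B) (hkl : k ≤ l) : RL B ω l x y := by
  obtain ⟨j, hj, h⟩ := h
  refine ⟨j, by omega, ?_⟩
  clear hj hkl
  induction h with
  | refl x hx => exact Reach.refl x (hAB hx)
  | step z h hyz hz ih => exact Reach.step z ih hyz (hAB hz)

lemma RL.symm {A : Set Site} {ω : Config} {k : ℕ} {x y : Site} (h : RL A ω k x y) :
    RL A ω k y x := by
  obtain ⟨j, hj, h⟩ := h
  exact ⟨j, hj, h.symm⟩

lemma RL.refl' {A : Set Site} {ω : Config} {k : ℕ} (hk : 1 ≤ k) {x : Site} (hx : x ∈ A) :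
    RL A ω k x x := ⟨_, (siteCost_le ω x).trans hk, Reach.refl x hx⟩

lemma Reach.map {A B : Set Site} {ω ω' : Config} (f : Site → Site)
    (hf : ∀ x y, Adj x y → Adj (f x) (f y)) (hA : ∀ x ∈ A, f x ∈ B)
    (hω : ∀ x ∈ A, ω' (f x) = true ∨ ω x = false) {k : ℕ} {x y : Site} (h : Reach A ω k x y) :
    RL B ω' k (f x) (f y) := by
  have hc : ∀ x ∈ A, siteCost ω' (f x) ≤ siteCost ω x := by
    intro x hx
    unfold siteCost
    rcases hω x hx with h | h
    · simp [h]
    · simp [h]; split_ifs <;> simp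
  induction h with
  | refl x hx => exact ⟨_, hc x hx, Reach.refl _ (hA x hx)⟩
  | step z h hyz hz ih =>
    obtain ⟨m, hm, H⟩ := ih
    refine ⟨_, ?_, Reach.step (f z) H (hf _ _ hyz) (hA z hz)⟩
    have := hc z hz
    omega

lemma RL.map {A B : Set Site} {ω ω' : Config} (f : Site → Site)
    (hf : ∀ x y, Adj x y → Adj (f x) (f y)) (hA : ∀ x ∈ A, f x ∈ B)
    (hω : ∀ x ∈ A, ω' (f x) = true ∨ ω x = false) {k : ℕ} {x y : Site} (h : RL A ω k x y) :
    RL B ω' k (f x) (f y) := by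
  obtain ⟨j, hj, h⟩ := h
  exact (h.map f hf hA hω).mono le_rfl hj

lemma RL.congr {A : Set Site} {ω ω' : Config} (hω : ∀ x ∈ A, ω x = ω' x) {k : ℕ} {x y : Site}
    (h : RL A ω k x y) : RL A ω' k x y := by
  refine h.map id (fun _ _ h => h) (fun _ h => h) ?_
  intro x hx
  have := hω x hx
  simp only [id, ← this]
  cases ω x <;> simp

lemma RL.list {A : Set Site} {ω : Config} {k : ℕ} {x y : Site} (h : RL A ω k x y) :
    ∃ γ, IsPathIn A x y γ ∧ pathCost ω γ ≤ k := by
  obtain ⟨j, hj, h⟩ := h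
  suffices H : ∃ γ, IsPathIn A x y γ ∧ pathCost ω γ = j by
    obtain ⟨γ, h1, h2⟩ := H
    exact ⟨γ, h1, by omega⟩
  clear hj
  induction h with
  | refl x hx =>
    refine ⟨[x], ⟨List.isChain_singleton _, by simp, by simp, by simpa using hx⟩, ?_⟩
    cases hx : ω x <;> simp [pathCost, siteCost, hx]
  | @step k' x' y' z h hyz hz ih =>
    obtain ⟨γ, ⟨h1, h2, h3, h4⟩, h5⟩ := ih
    refine ⟨γ ++ [z], ⟨?_, ?_, by simp, ?_⟩, ?_⟩
    · refine List.isChain_append.2 ⟨h1, by simp, ?_⟩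
      intro a ha b hb
      rw [h3] at ha
      simp at ha hb
      subst ha hb
      exact hyz
    · rw [List.head?_append, h2]; rfl
    · intro w hw
      rcases List.mem_append.1 hw with hw | hw
      · exact h4 w hw
      · simp at hw; subst hw; exact hz
    · unfold pathCost at *
      rw [List.countP_append, h5]
      cases hz : ω z <;> simp [siteCost, hz]

lemma RL.travelTime_le {A : Set Site} {ω : Config} {k : ℕ} {x y : Site} (h : RL A ω k x y) :
    travelTime ω A x y ≤ (k : ℝ≥0∞) := by
  obtain ⟨γ, h1, h2⟩ := h.list
  have h3 : travelTime ω A x y ≤ (pathCost ω γ : ℝ≥0∞) := sInf_le ⟨γ, h1, rfl⟩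
  exact h3.trans (by exact_mod_cast h2)

/-- Exiting a set along an open path. -/
lemma exit_of_path {A : Set Site} {ω : Config} {u : Site} (γ : List Site) :
    ∀ (x y : Site), Reach A ω 0 u x → IsPathIn {z | ω z = true} x y γ → y ∉ A →
      ∃ v ∈ intBd A, Reach A ω 0 u v := by
  induction γ with
  | nil => rintro x y - ⟨-, h, -⟩; simp at h
  | cons a γ ih =>
    rintro x y hx ⟨h1, h2, h3, h4⟩ hy
    simp at h2
    subst h2
    cases γ with
    | nil =>
      simp at h3
      subst h3
      exact absurd hx.right_mem hy
    | cons b γ =>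
      have hab : Adj a b := (List.isChain_cons_cons.1 h1).1
      by_cases hb : b ∈ A
      · refine ih b y ?_ ⟨(List.isChain_cons_cons.1 h1).2, by simp, ?_, ?_⟩ hy
        · have := Reach.step b hx hab hb
          have hbo : ω b = true := h4 b (by simp)
          simpa [siteCost, hbo] using this
        · simpa using h3
        · intro z hz
          exact h4 z (by simp at hz ⊢; tauto)
      · exact ⟨a, ⟨hx.right_mem, b, hb, hab⟩, hx⟩

lemma hit_of_infinite {A : Set Site} (hA : A.Finite) {ω : Config} (h0 : (0 : Site) ∈ A)
    (h : (cluster ω 0).Infinite) : ∃ v ∈ intBd A, RL A ω 0 0 v := by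
  obtain ⟨y, ⟨γ, hγ⟩, hyA⟩ := h.exists_notMem_finite hA
  have hop : ω 0 = true := by
    obtain ⟨h1, h2, h3, h4⟩ := hγ
    exact h4 0 (List.mem_of_mem_head? (by simp [h2]))
  have hr : Reach A ω 0 0 0 := by
    simpa [siteCost, hop] using Reach.refl (A := A) (ω := ω) 0 h0
  obtain ⟨v, hv, H⟩ := exit_of_path γ 0 y hr hγ hyA
  exact ⟨v, hv, 0, le_rfl, H⟩

/-! ### The deterministic routing argument -/

/-- The good event: from every site one can travel cheaply to every quarter face. -/
def Good (n k : ℕ) (ω : Config) : Prop :=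
  ∀ x : Site, ∀ r : ℤ, 1 ≤ r → r ≤ n → (∀ j, |x j| + r ≤ n) → ∀ (i : Fin 3) (e : Fin 3 → Bool),
    ∃ v : Site, v i - x i = (if e i then r else -r) ∧
      (∀ j, if e j then 0 ≤ v j - x j ∧ v j - x j ≤ r else v j - x j ≤ 0 ∧ -r ≤ v j - x j) ∧
      RL (box n) ω k x v

lemma mem_box_iff {n : ℕ} {x : Site} : x ∈ box n ↔ ∀ j, |x j| ≤ (n : ℤ) := by
  unfold box
  constructor
  · intro h j
    have := h j
    exact_mod_cast this
  · intro h j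
    have := h j
    exact_mod_cast this

lemma route_one {n k : ℕ} {ω : Config} (hG : Good n k ω) (hk : 1 ≤ k) {d r : ℤ} (hr : 1 ≤ r)
    (hrd : 2 * r ≤ d) (hdn : d + r ≤ n) (i : Fin 3) (x : Site) (hx : ∀ j, |x j| ≤ d) :
    ∃ v : Site, (∀ j, |v j| ≤ d) ∧ |v i| ≤ d - r ∧ (∀ j, |x j| ≤ d - r → |v j| ≤ d - r) ∧
      RL (box n) ω k x v := by
  by_cases hxi : |x i| ≤ d - r
  · refine ⟨x, hx, hxi, fun j h => h, RL.refl' hk ?_⟩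
    rw [mem_box_iff]
    intro j
    have := hx j
    omega
  · obtain ⟨v, h1, h2, h3⟩ := hG x r hr (by omega) (fun j => by have := hx j; omega) i
      (fun j => decide (x j < 0))
    have key : ∀ j, |v j| ≤ |x j| ∨ |v j| ≤ r := by
      intro j
      have := h2 j
      by_cases hj : x j < 0
      · simp only [hj, decide_true, if_true] at this
        rw [abs_of_neg hj]
        rcases le_total 0 (v j) with h | h
        · right; rw [abs_of_nonneg h]; omega
        · left; rw [abs_of_nonpos h]; omega
      · simp only [hj, decide_false] at this
        rw [abs_of_nonneg (not_lt.1 hj)]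
        rcases le_total 0 (v j) with h | h
        · left; rw [abs_of_nonneg h]; simp at this; omega
        · right; rw [abs_of_nonpos h]; simp at this; omega
    refine ⟨v, fun j => ?_, ?_, fun j hj => ?_, h3⟩
    · have := hx j
      rcases key j with h | h <;> omega
    · have hxd := hx i
      rw [not_le] at hxi
      by_cases hj : x i < 0
      · simp only [hj, decide_true, if_true] at h1
        rw [abs_of_neg hj] at hxi hxd
        rw [abs_le]; omega
      · simp [hj] at h1
        rw [abs_of_nonneg (not_lt.1 hj)] at hxi hxd
        rw [abs_le]; omega
    · rcases key j with h | h <;> omega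

lemma route_three {n k : ℕ} {ω : Config} (hG : Good n k ω) (hk : 1 ≤ k) {d r : ℤ} (hr : 1 ≤ r)
    (hrd : 2 * r ≤ d) (hdn : d + r ≤ n) (x : Site) (hx : ∀ j, |x j| ≤ d) :
    ∃ v : Site, (∀ j, |v j| ≤ d - r) ∧ RL (box n) ω (3 * k) x v := by
  obtain ⟨v0, a0, b0, c0, h0⟩ := route_one hG hk hr hrd hdn 0 x hx
  obtain ⟨v1, a1, b1, c1, h1⟩ := route_one hG hk hr hrd hdn 1 v0 a0
  obtain ⟨v2, a2, b2, c2, h2⟩ := route_one hG hk hr hrd hdn 2 v1 a1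
  refine ⟨v2, ?_, ((h0.trans h1).trans h2).mono le_rfl (by omega)⟩
  intro j
  fin_cases j
  · exact c2 0 (c1 0 b0)
  · exact c2 1 b1
  · exact b2

/-- The elementary move of one coordinate towards `0`. -/
lemma walk_one {n : ℕ} (ω : Config) {d : ℤ} (hd : 1 ≤ d)
    (hdn : d ≤ n) (i : Fin 3) (x : Site) (hx : ∀ j, |x j| ≤ d) :
    ∃ v : Site, (∀ j, |v j| ≤ d) ∧ |v i| ≤ d - 1 ∧ (∀ j, |x j| ≤ d - 1 → |v j| ≤ d - 1) ∧
      RL (box n) ω 2 x v := by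
  have hxb : x ∈ box n := by
    rw [mem_box_iff]; intro j; exact (hx j).trans hdn
  by_cases hxi : |x i| ≤ d - 1
  · exact ⟨x, hx, hxi, fun j h => h, RL.refl' (by norm_num) hxb⟩
  · set c : ℤ := if x i < 0 then x i + 1 else x i - 1 with hc
    have hcx : |x i - c| = 1 := by
      rw [hc]; split_ifs <;> simp
    have hcd : |c| ≤ d - 1 := by
      have h1 := hx i
      rw [abs_le] at h1 ⊢
      rw [not_le] at hxi
      rw [hc]
      split_ifs with h
      · omega
      · rw [abs_of_nonneg (not_lt.1 h)] at hxi; omega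
    have hv : ∀ j, |Function.update x i c j| ≤ d := by
      intro j
      by_cases hj : j = i
      · subst hj; simp; omega
      · simp [hj, hx j]
    have hvb : Function.update x i c ∈ box n := by
      rw [mem_box_iff]; intro j; exact (hv j).trans hdn
    have hadj : Adj x (Function.update x i c) := by
      unfold Adj
      rw [Finset.sum_eq_single i]
      · simpa using hcx
      · intro j _ hj; simp [hj]
      · simp
    refine ⟨Function.update x i c, hv, by simpa using hcd, ?_, ?_⟩
    · intro j hj
      by_cases hji : j = i
      · subst hji; simpa using hcd
      · simpa [hji] using hj
    · refine ⟨_, ?_, Reach.step _ (Reach.refl x hxb) hadj hvb⟩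
      have h1 := siteCost_le ω x
      have h2 := siteCost_le ω (Function.update x i c)
      omega

lemma walk_three {n : ℕ} (ω : Config) {d : ℤ} (hd : 1 ≤ d)
    (hdn : d ≤ n) (x : Site) (hx : ∀ j, |x j| ≤ d) :
    ∃ v : Site, (∀ j, |v j| ≤ d - 1) ∧ RL (box n) ω 6 x v := by
  obtain ⟨v0, a0, b0, c0, h0⟩ := walk_one ω hd hdn 0 x hx
  obtain ⟨v1, a1, b1, c1, h1⟩ := walk_one ω hd hdn 1 v0 a0
  obtain ⟨v2, a2, b2, c2, h2⟩ := walk_one ω hd hdn 2 v1 a1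
  refine ⟨v2, ?_, ((h0.trans h1).trans h2).mono le_rfl (by omega)⟩
  intro j
  fin_cases j
  · exact c2 0 (c1 0 b0)
  · exact c2 1 b1
  · exact b2

lemma phase_two {n k : ℕ} {ω : Config} (hG : Good n k ω) (hk : 1 ≤ k) (t : ℕ) :
    ∀ (d : ℤ), 0 ≤ d → d ≤ 2 ^ t → 3 * d ≤ 2 * n → ∀ x : Site, (∀ j, |x j| ≤ d) →
      RL (box n) ω (3 * k * t + 6) x 0 := by
  have base : ∀ (d : ℤ), 0 ≤ d → d ≤ 1 → 3 * d ≤ 2 * n → ∀ x : Site, (∀ j, |x j| ≤ d) →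
      RL (box n) ω 6 x 0 := by
    intro d h0 h1 h2 x hx
    have hz : ∀ v : Site, (∀ j, |v j| ≤ 0) → v = 0 := by
      intro v hv
      funext j
      simpa using hv j
    rcases (show d = 0 ∨ d = 1 by omega) with rfl | rfl
    · rw [hz x hx]
      refine RL.refl' (by norm_num) ?_
      rw [mem_box_iff]; simp
    · obtain ⟨v, hv, h⟩ := walk_three (n := n) ω le_rfl (by omega) x hx
      rw [hz v (by simpa using hv)] at h
      exact h
  induction t with
  | zero =>
    intro d h0 h1 h2 x hx
    exact (base d h0 (by simpa using h1) h2 x hx).mono le_rfl (by omega)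
  | succ t ih =>
    intro d h0 h1 h2 x hx
    by_cases hd : d ≤ 1
    · exact (base d h0 hd h2 x hx).mono le_rfl (by omega)
    · rw [pow_succ] at h1
      obtain ⟨v, hv, h⟩ := route_three hG hk (d := d) (r := d / 2) (by omega) (by omega)
        (by omega) x hx
      have := ih (d - d / 2) (by omega) (by omega) (by omega) v hv
      exact (h.trans this).mono le_rfl (by ring_nf; omega)

lemma phase_one {n k : ℕ} {ω : Config} (hG : Good n k ω) (hk : 1 ≤ k) (s : ℕ)
    (hs : (n : ℤ) ≤ 2 ^ s) (t : ℕ) :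
    ∀ (d : ℤ), 0 ≤ d → d < n → (n : ℤ) ≤ 3 * 2 ^ t * (n - d) → ∀ x : Site, (∀ j, |x j| ≤ d) →
      RL (box n) ω (3 * k * t + (3 * k * s + 6)) x 0 := by
  induction t with
  | zero =>
    intro d h0 h1 h2 x hx
    exact (phase_two hG hk s d h0 (by omega) (by omega) x hx).mono le_rfl (by omega)
  | succ t ih =>
    intro d h0 h1 h2 x hx
    by_cases hd : 3 * d ≤ 2 * n
    · exact (phase_two hG hk s d h0 (by omega) (by omega) x hx).mono le_rfl (by omega)
    · obtain ⟨v, hv, h⟩ := route_three hG hk (d := d) (r := n - d) (by omega) (by omega)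
        (by omega) x hx
      have := ih (d - (n - d)) (by omega) (by omega) (by rw [pow_succ] at h2; linarith) v hv
      exact (h.trans this).mono le_rfl (by ring_nf; omega)

lemma route_center {n k : ℕ} (hn : 2 ≤ n) {ω : Config} (hG : Good n k ω) (hk : 1 ≤ k) (s : ℕ)
    (hs : n ≤ 2 ^ s) (x : Site) (hx : x ∈ box n) :
    RL (box n) ω (6 * k * s + 12) x 0 := by
  rw [mem_box_iff] at hx
  have hs' : (n : ℤ) ≤ 2 ^ s := by exact_mod_cast hs
  obtain ⟨v, hv, h⟩ := walk_three (n := n) (d := n) ω (by omega) le_rfl x hx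
  have := phase_one hG hk s hs' s (n - 1) (by omega) (by omega) (by linarith) v hv
  exact (h.trans this).mono le_rfl (by ring_nf; omega)

lemma route_all {n k : ℕ} (hn : 2 ≤ n) {ω : Config} (hG : Good n k ω) (hk : 1 ≤ k) (s : ℕ)
    (hs : n ≤ 2 ^ s) (x y : Site) (hx : x ∈ box n) (hy : y ∈ box n) :
    travelTime ω (box n) x y ≤ ((12 * k * s + 24 : ℕ) : ℝ≥0∞) := by
  have h1 := route_center hn hG hk s hs x hx
  have h2 := route_center hn hG hk s hs y hy
  exact ((h1.trans h2.symm).mono le_rfl (by ring_nf; omega)).travelTime_le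

/-! ### Events depending on finitely many sites -/

/-- The configuration with open set `t`. -/
def cfg (t : Finset Site) : Config := fun z => decide (z ∈ t)

/-- The event `E` depends only on the sites of `S`. -/
def Dep (E : Set Config) (S : Finset Site) : Prop :=
  ∀ ω ω' : Config, (∀ z ∈ S, ω z = ω' z) → ω ∈ E → ω' ∈ E

/-- A cylinder. -/
def Cyl (S t : Finset Site) : Set Config := {ω | ∀ z ∈ S, ω z = cfg t z}

/-- The weight of a cylinder. -/
def wt (p : ℝ) (S t : Finset Site) : ℝ := ∏ z ∈ S, if z ∈ t then p else 1 - p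

lemma measurableSet_cylF (S : Finset Site) (f : Config) :
    MeasurableSet {ω : Config | ∀ z ∈ S, ω z = f z} := by
  have : {ω : Config | ∀ z ∈ S, ω z = f z} = ⋂ z ∈ S, (fun ω : Config => ω z) ⁻¹' {f z} := by
    ext ω; simp
  rw [this]
  exact Finset.measurableSet_biInter _ fun z _ => measurable_pi_apply z (measurableSet_singleton _)

lemma measurableSet_cyl (S t : Finset Site) : MeasurableSet (Cyl S t) := measurableSet_cylF S _

lemma cyl_disjoint {S t t' : Finset Site} (ht : t ⊆ S) (ht' : t' ⊆ S) (h : t ≠ t') :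
    Disjoint (Cyl S t) (Cyl S t') := by
  rw [Set.disjoint_left]
  intro ω h1 h2
  apply h
  ext z
  by_cases hz : z ∈ S
  · have := (h1 z hz).symm.trans (h2 z hz)
    simpa [cfg] using this
  · exact ⟨fun h => absurd (ht h) hz, fun h => absurd (ht' h) hz⟩

open Classical in
lemma dep_eq_iUnion {E : Set Config} {S : Finset Site} (hE : Dep E S) :
    E = ⋃ t ∈ S.powerset.filter (fun t => cfg t ∈ E), Cyl S t := by
  ext ω
  simp only [Set.mem_iUnion, Finset.mem_filter, Finset.mem_powerset, exists_prop]
  constructor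
  · intro h
    have hag : ∀ z ∈ S, ω z = cfg (S.filter fun z => ω z = true) z := by
      intro z hz
      cases hω : ω z <;> simp [cfg, hz, hω]
    exact ⟨S.filter fun z => ω z = true, ⟨Finset.filter_subset _ _, hE _ _ hag h⟩, hag⟩
  · rintro ⟨t, ⟨-, h1⟩, h2⟩
    exact hE _ _ (fun z hz => (h2 z hz).symm) h1

lemma dep_measurable {E : Set Config} {S : Finset Site} (hE : Dep E S) : MeasurableSet E := by
  classical
  rw [dep_eq_iUnion hE]
  exact Finset.measurableSet_biUnion _ fun t _ => measurableSet_cyl S t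

open Classical in
lemma real_inter_eq_sum (P : Measure Config) [IsProbabilityMeasure P] {E G : Set Config}
    {S : Finset Site} (hE : Dep E S) (hG : MeasurableSet G) :
    P.real (E ∩ G) = ∑ t ∈ S.powerset.filter (fun t => cfg t ∈ E), P.real (Cyl S t ∩ G) := by
  conv_lhs => rw [dep_eq_iUnion hE, Set.iUnion₂_inter]
  refine measureReal_biUnion_finset ?_ fun t _ => (measurableSet_cyl S t).inter hG
  intro t ht t' ht' hne
  simp only [Finset.coe_filter, Finset.mem_powerset, Set.mem_setOf_eq] at ht ht'
  exact (cyl_disjoint ht.1 ht'.1 hne).mono Set.inter_subset_left Set.inter_subset_left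

lemma real_cylF {p : ℝ} (hp : p ∈ Set.Icc (0 : ℝ) 1) {P : Measure Config} (hP : IsBernoulli p P)
    (S : Finset Site) (f : Config) :
    P.real {ω : Config | ∀ z ∈ S, ω z = f z} = ∏ z ∈ S, if f z then p else 1 - p := by
  rw [measureReal_def, hP, ENNReal.toReal_prod]
  refine Finset.prod_congr rfl fun z _ => ?_
  split_ifs
  · exact ENNReal.toReal_ofReal hp.1
  · exact ENNReal.toReal_ofReal (by linarith [hp.2])

lemma real_cyl {p : ℝ} (hp : p ∈ Set.Icc (0 : ℝ) 1) {P : Measure Config} (hP : IsBernoulli p P)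
    (S t : Finset Site) : P.real (Cyl S t) = wt p S t := by
  unfold Cyl wt
  rw [real_cylF hp hP]
  simp [cfg]

open Classical in
lemma real_eq_sum {p : ℝ} (hp : p ∈ Set.Icc (0 : ℝ) 1) {P : Measure Config}
    [IsProbabilityMeasure P] (hP : IsBernoulli p P) {E : Set Config} {S : Finset Site}
    (hE : Dep E S) :
    P.real E = ∑ t ∈ S.powerset.filter (fun t => cfg t ∈ E), wt p S t := by
  have := real_inter_eq_sum P hE MeasurableSet.univ
  simpa [real_cyl hp hP] using this

lemma real_indep {p : ℝ} (hp : p ∈ Set.Icc (0 : ℝ) 1) {P : Measure Config}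
    [IsProbabilityMeasure P] (hP : IsBernoulli p P) {E F : Set Config} {S T : Finset Site}
    (hE : Dep E S) (hF : Dep F T) (hST : Disjoint S T) :
    P.real (E ∩ F) = P.real E * P.real F := by
  classical
  rw [real_inter_eq_sum P hE (dep_measurable hF), real_eq_sum hp hP hE, real_eq_sum hp hP hF,
    Finset.sum_mul_sum]
  refine Finset.sum_congr rfl fun t _ => ?_
  rw [Set.inter_comm, real_inter_eq_sum P hF (measurableSet_cyl S t)]
  refine Finset.sum_congr rfl fun t' _ => ?_
  have : Cyl T t' ∩ Cyl S t =
      {ω : Config | ∀ z ∈ S ∪ T, ω z = if z ∈ S then cfg t z else cfg t' z} := by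
    ext ω
    simp only [Cyl, Set.mem_inter_iff, Set.mem_setOf_eq, Finset.mem_union]
    constructor
    · rintro ⟨h1, h2⟩ z hz
      by_cases hzS : z ∈ S
      · simp [hzS, h2 z hzS]
      · simp [hzS, h1 z (hz.resolve_left hzS)]
    · intro h
      refine ⟨fun z hz => ?_, fun z hz => ?_⟩
      · have := h z (Or.inr hz)
        rwa [if_neg (Finset.disjoint_right.1 hST hz)] at this
      · have := h z (Or.inl hz)
        rwa [if_pos hz] at this
  rw [this, real_cylF hp hP, Finset.prod_union hST]
  unfold wt
  congr 1
  · refine Finset.prod_congr rfl fun z hz => ?_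
    simp [hz, cfg]
  · refine Finset.prod_congr rfl fun z hz => ?_
    simp [Finset.disjoint_right.1 hST hz, cfg]

lemma wt_nonneg {p : ℝ} (hp : p ∈ Set.Icc (0 : ℝ) 1) (S t : Finset Site) : 0 ≤ wt p S t := by
  refine Finset.prod_nonneg fun z _ => ?_
  split_ifs
  · exact hp.1
  · linarith [hp.2]

lemma wt_mul (p : ℝ) (S a b : Finset Site) :
    wt p S a * wt p S b = wt p S (a ⊓ b) * wt p S (a ⊔ b) := by
  unfold wt
  rw [← Finset.prod_mul_distrib, ← Finset.prod_mul_distrib]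
  refine Finset.prod_congr rfl fun z _ => ?_
  by_cases ha : z ∈ a <;> by_cases hb : z ∈ b <;> simp [ha, hb, mul_comm]

/-- Decreasing events. -/
def Decr (E : Set Config) : Prop := ∀ ω ω' : Config, (∀ z, ω' z = true → ω z = true) →
  ω ∈ E → ω' ∈ E

lemma real_fkg {p : ℝ} (hp : p ∈ Set.Icc (0 : ℝ) 1) {P : Measure Config}
    [IsProbabilityMeasure P] (hP : IsBernoulli p P) {E F : Set Config} {S : Finset Site}
    (hE : Dep E S) (hF : Dep F S) (hE' : Decr E) (hF' : Decr F) :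
    P.real E * P.real F ≤ P.real (E ∩ F) := by
  classical
  have hEF : Dep (E ∩ F) S := fun ω ω' h ⟨h1, h2⟩ => ⟨hE ω ω' h h1, hF ω ω' h h2⟩
  have huniv : Dep Set.univ S := fun ω ω' h _ => trivial
  have hone : ∑ t ∈ S.powerset, wt p S t = 1 := by
    have := real_eq_sum hp hP huniv
    simpa using this.symm
  obtain ⟨G, hG⟩ : ∃ G, G = E ∩ F := ⟨_, rfl⟩
  rw [← hG] at hEF ⊢
  rw [real_eq_sum hp hP hE, real_eq_sum hp hP hF, real_eq_sum hp hP hEF]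
  simp only [Finset.sum_filter]
  have key := four_functions_theorem (fun t => if cfg t ∈ E then wt p S t else 0)
    (fun t => if cfg t ∈ F then wt p S t else 0)
    (fun t => if cfg t ∈ G then wt p S t else 0) (fun t => wt p S t)
    (fun t => by dsimp; split_ifs; exacts [wt_nonneg hp S t, le_rfl])
    (fun t => by dsimp; split_ifs; exacts [wt_nonneg hp S t, le_rfl])
    (fun t => by dsimp; split_ifs; exacts [wt_nonneg hp S t, le_rfl])
    (fun t => wt_nonneg hp S t) (by
      intro a b
      by_cases ha : cfg a ∈ E
      · by_cases hb : cfg b ∈ F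
        · have h1 : cfg (a ⊓ b) ∈ E := hE' _ _ (by intro z; simp [cfg]; tauto) ha
          have h2 : cfg (a ⊓ b) ∈ F := hF' _ _ (by intro z; simp [cfg]) hb
          rw [if_pos ha, if_pos hb, if_pos (by rw [hG]; exact ⟨h1, h2⟩), wt_mul]
        · rw [if_neg hb, mul_zero]
          refine mul_nonneg ?_ (wt_nonneg hp _ _)
          split_ifs
          exacts [wt_nonneg hp _ _, le_rfl]
      · rw [if_neg ha, zero_mul]
        refine mul_nonneg ?_ (wt_nonneg hp _ _)
        split_ifs
        exacts [wt_nonneg hp _ _, le_rfl]) S.powerset S.powerset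
  refine key.trans ?_
  rw [← mul_one (∑ t ∈ S.powerset, _), ← hone]
  refine mul_le_mul (Finset.sum_le_sum_of_subset_of_nonneg ?_ ?_)
    (Finset.sum_le_sum_of_subset_of_nonneg ?_ ?_) ?_ ?_
  · intro c hc
    obtain ⟨a, ha, b, hb, rfl⟩ := Finset.mem_infs.1 hc
    rw [Finset.mem_powerset] at *
    exact Finset.inter_subset_left.trans ha
  · intro t _ _
    split_ifs
    exacts [wt_nonneg hp _ _, le_rfl]
  · intro c hc
    obtain ⟨a, ha, b, hb, rfl⟩ := Finset.mem_sups.1 hc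
    rw [Finset.mem_powerset] at *
    exact Finset.union_subset ha hb
  · intro t _ _
    exact wt_nonneg hp _ _
  · exact Finset.sum_nonneg fun t _ => wt_nonneg hp _ _
  · refine Finset.sum_nonneg fun t _ => ?_
    split_ifs
    exacts [wt_nonneg hp _ _, le_rfl]

lemma real_fkg_prod {p : ℝ} (hp : p ∈ Set.Icc (0 : ℝ) 1) {P : Measure Config}
    [IsProbabilityMeasure P] (hP : IsBernoulli p P) {ι : Type} (I : Finset ι)
    (E : ι → Set Config) {S : Finset Site}
    (hE : ∀ i, Dep (E i) S) (hE' : ∀ i, Decr (E i)) :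
    ∏ i ∈ I, P.real (E i) ≤ P.real (⋂ i ∈ I, E i) := by
  classical
  induction I using Finset.induction_on with
  | empty => simp
  | insert a I ha ih =>
    rw [Finset.prod_insert ha, Finset.set_biInter_insert]
    refine (mul_le_mul_of_nonneg_left ih measureReal_nonneg).trans ?_
    refine real_fkg hp hP (hE a) (S := S) ?_ (hE' a) ?_
    · intro ω ω' h h1
      simp only [Set.mem_iInter] at *
      exact fun i hi => hE i ω ω' h (h1 i hi)
    · intro ω ω' h h1
      simp only [Set.mem_iInter] at *
      exact fun i hi => hE' i ω ω' h (h1 i hi)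

/-- Invariance under a bijection of the sites. -/
lemma real_equiv {p : ℝ} (hp : p ∈ Set.Icc (0 : ℝ) 1) {P : Measure Config}
    [IsProbabilityMeasure P] (hP : IsBernoulli p P) (σ : Site ≃ Site) {E : Set Config}
    {S : Finset Site} (hE : Dep E S) :
    P.real {ω | (fun z => ω (σ z)) ∈ E} = P.real E := by
  classical
  have hm : Measurable (fun (ω : Config) (z : Site) => ω (σ z)) :=
    measurable_pi_lambda _ fun z => measurable_pi_apply _
  have hprob : IsProbabilityMeasure (P.map (fun (ω : Config) (z : Site) => ω (σ z))) :=
    Measure.isProbabilityMeasure_map hm.aemeasurable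
  have hB : IsBernoulli p (P.map (fun (ω : Config) (z : Site) => ω (σ z))) := by
    intro s f
    rw [Measure.map_apply hm (measurableSet_cylF s f)]
    have := hP (s.map σ.toEmbedding) (fun z => f (σ.symm z))
    rw [Finset.prod_map] at this
    have hset : {ω : Config | ∀ z ∈ s.map σ.toEmbedding, ω z = f (σ.symm z)} =
        (fun (ω : Config) (z : Site) => ω (σ z)) ⁻¹' {ω | ∀ z ∈ s, ω z = f z} := by
      ext ω
      constructor
      · intro h z hz
        have := h (σ z) (Finset.mem_map_of_mem _ hz)
        simpa using this
      · intro h z hz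
        obtain ⟨w, hw, rfl⟩ := Finset.mem_map.1 hz
        have := h w hw
        simpa using this
    rw [← hset, this]
    simp
  rw [real_eq_sum hp hP hE, ← real_eq_sum hp hB hE,
    map_measureReal_apply hm (dep_measurable hE)]
  rfl

/-! ### Exploration from the boundary -/

/-- The event that the origin reaches the boundary of `A` with cost at most `k`. -/
def Hit (A : Finset Site) (k : ℕ) : Set Config := {ω | ∃ v ∈ intBd (A : Set Site), RL A ω k 0 v}

/-- Sites connected to the boundary by an open path. -/
def outer (A : Finset Site) (ω : Config) : Set Site :=
  {v | ∃ b ∈ intBd (A : Set Site), Reach A ω 0 b v}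

open Classical in
/-- The explored set. -/
def expl (A : Finset Site) (ω : Config) : Finset Site :=
  A.filter fun v => v ∈ intBd (A : Set Site) ∨ v ∈ outer A ω ∨ ∃ w ∈ outer A ω, Adj v w

lemma mem_expl {A : Finset Site} {ω : Config} {v : Site} : v ∈ expl A ω ↔
    v ∈ A ∧ (v ∈ intBd (A : Set Site) ∨ v ∈ outer A ω ∨ ∃ w ∈ outer A ω, Adj v w) := by
  classical
  unfold expl
  rw [Finset.mem_filter]

lemma siteCost_congr {ω ω' : Config} {z : Site} (h : ω z = ω' z) :
    siteCost ω z = siteCost ω' z := by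
  unfold siteCost
  rw [h]

lemma outer_sub {A : Finset Site} {ω : Config} {v : Site} (h : v ∈ outer A ω) : v ∈ expl A ω := by
  obtain ⟨b, hb, H⟩ := h
  exact mem_expl.2 ⟨H.right_mem, Or.inr (Or.inl ⟨b, hb, H⟩)⟩

lemma reach_local1 {A : Finset Site} {ω ω' : Config} (h : ∀ z ∈ expl A ω, ω z = ω' z)
    {k : ℕ} {b v : Site} (hb : b ∈ intBd (A : Set Site)) (H : Reach A ω k b v) (hk : k = 0) :
    Reach A ω' 0 b v := by
  induction H with
  | refl x hx =>
    have h1 := h x (mem_expl.2 ⟨hx, Or.inl hb⟩)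
    rw [siteCost_congr h1] at hk
    have := Reach.refl (ω := ω') x hx
    rwa [hk] at this
  | @step k x y z H hyz hz ih =>
    obtain ⟨hk0, hz0⟩ : k = 0 ∧ siteCost ω z = 0 := by omega
    have H2 := Reach.step z H hyz hz
    rw [hk] at H2
    have h1 := h z (outer_sub ⟨_, hb, H2⟩)
    have := Reach.step z (ih hb hk0) hyz hz
    rw [← siteCost_congr h1, hz0] at this
    exact this

lemma reach_local2 {A : Finset Site} {ω ω' : Config} (h : ∀ z ∈ expl A ω, ω z = ω' z)
    {k : ℕ} {b v : Site} (hb : b ∈ intBd (A : Set Site)) (H : Reach A ω' k b v) (hk : k = 0) :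
    Reach A ω 0 b v := by
  induction H with
  | refl x hx =>
    have h1 := h x (mem_expl.2 ⟨hx, Or.inl hb⟩)
    rw [← siteCost_congr h1] at hk
    have := Reach.refl (ω := ω) x hx
    rwa [hk] at this
  | @step k x y z H hyz hz ih =>
    obtain ⟨hk0, hz0⟩ : k = 0 ∧ siteCost ω' z = 0 := by omega
    have H2 := ih hb hk0
    have h1 := h z (mem_expl.2 ⟨hz, Or.inr (Or.inr ⟨y, ⟨_, hb, H2⟩, hyz.symm'⟩)⟩)
    have := Reach.step z H2 hyz hz
    rw [siteCost_congr h1, hz0] at this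
    exact this

lemma expl_local {A : Finset Site} {ω ω' : Config} (h : ∀ z ∈ expl A ω, ω z = ω' z) :
    expl A ω' = expl A ω := by
  have ho : outer A ω' = outer A ω := by
    ext v
    constructor
    · rintro ⟨b, hb, H⟩
      exact ⟨b, hb, reach_local2 h hb H rfl⟩
    · rintro ⟨b, hb, H⟩
      exact ⟨b, hb, reach_local1 h hb H rfl⟩
  ext v
  rw [mem_expl, mem_expl, ho]

lemma dep_expl (A S : Finset Site) : Dep {ω | expl A ω = S} S := by
  intro ω ω' h hω
  have hω : expl A ω = S := hω
  show expl A ω' = S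
  rw [← hω]
  apply expl_local
  rw [hω]
  exact h

lemma dep_hit_compl (A : Finset Site) (k : ℕ) : Dep (Hit A k)ᶜ A := by
  rintro ω ω' h hω ⟨v, hv, H⟩
  exact hω ⟨v, hv, H.congr fun z hz => (h z hz).symm⟩

lemma expl_step {A : Finset Site} {k : ℕ} {ω : Config} (hω : ω ∉ Hit A (k + 1))
    (h0 : (0 : Site) ∈ A) : (0 : Site) ∉ expl A ω ∧ ω ∉ Hit (A \ expl A ω) k := by
  constructor
  · intro h
    apply hω
    rcases (mem_expl.1 h).2 with h | ⟨b, hb, H⟩ | ⟨w, ⟨b, hb, H⟩, hw⟩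
    · exact ⟨0, h, RL.refl' (by omega) h0⟩
    · exact ⟨b, hb, 0, by omega, H.symm⟩
    · have := siteCost_le ω 0
      exact ⟨b, hb, _, by omega, H.symm.cons hw h0⟩
  · rintro ⟨v, ⟨hv, y, hy, hvy⟩, H⟩
    have hv' := Finset.mem_sdiff.1 (Finset.mem_coe.1 hv)
    have hsub : ((A \ expl A ω : Finset Site) : Set Site) ⊆ A := by
      intro z hz
      exact (Finset.mem_sdiff.1 (Finset.mem_coe.1 hz)).1
    obtain ⟨j, hj, H⟩ := H.mono hsub le_rfl
    by_cases hyA : y ∈ A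
    · have hyS : y ∈ expl A ω := by
        by_contra hc
        exact hy (Finset.mem_coe.2 (Finset.mem_sdiff.2 ⟨hyA, hc⟩))
      have hc := siteCost_le ω y
      have H2 := Reach.step y H hvy hyA
      rcases (mem_expl.1 hyS).2 with h | h | ⟨w, ⟨b, hb, H3⟩, hw⟩
      · exact hω ⟨y, h, _, by omega, H2⟩
      · exact hv'.2 (mem_expl.2 ⟨hv'.1, Or.inr (Or.inr ⟨y, h, hvy⟩)⟩)
      · have H4 : RL A ω (k + 1) 0 y := ⟨_, by omega, H2⟩
        have hw0 : siteCost ω w = 0 := by have := H3.cost_right; omega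
        have H5 := Reach.step w H2 hw H3.right_mem
        have H6 : RL A ω (k + 1) 0 w := ⟨_, by omega, H5⟩
        exact hω ⟨b, hb, H6.trans ⟨0, le_rfl, H3.symm⟩⟩
    · exact hv'.2 (mem_expl.2 ⟨hv'.1, Or.inl ⟨hv'.1, y, hyA, hvy⟩⟩)

lemma hit_bound {p : ℝ} (hp : p ∈ Set.Icc (0 : ℝ) 1) {P : Measure Config}
    [IsProbabilityMeasure P] (hP : IsBernoulli p P) (k : ℕ) :
    ∀ A : Finset Site, (0 : Site) ∈ A →
      P.real (Hit A k)ᶜ ≤ (1 - (theta P).toReal) ^ (k + 1) := by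
  classical
  have base : ∀ A : Finset Site, (0 : Site) ∈ A → P.real (Hit A 0)ᶜ ≤ 1 - (theta P).toReal := by
    intro A h0
    have hm : MeasurableSet (Hit A 0) := by
      have := (dep_measurable (dep_hit_compl A 0)).compl
      rwa [compl_compl] at this
    rw [probReal_compl_eq_one_sub hm]
    have : (theta P).toReal ≤ P.real (Hit A 0) := by
      refine measureReal_mono ?_
      intro ω hω
      exact hit_of_infinite A.finite_toSet (Finset.mem_coe.2 h0) hω
    linarith
  have hq : 0 ≤ 1 - (theta P).toReal := by
    have := base {0} (by simp)
    exact measureReal_nonneg.trans this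
  induction k with
  | zero => simpa using base
  | succ k ih =>
    intro A h0
    set I := A.powerset.filter (fun S => (0 : Site) ∉ S) with hI
    have hsub : (Hit A (k + 1))ᶜ ⊆ ⋃ S ∈ I, ({ω | expl A ω = S} ∩ (Hit (A \ S) k)ᶜ) := by
      intro ω hω
      obtain ⟨h1, h2⟩ := expl_step hω h0
      simp only [Set.mem_iUnion]
      refine ⟨expl A ω, ?_, rfl, h2⟩
      rw [hI, Finset.mem_filter, Finset.mem_powerset]
      exact ⟨fun z hz => (mem_expl.1 hz).1, h1⟩
    have hsum : ∑ S ∈ I, P.real {ω | expl A ω = S} ≤ 1 - (theta P).toReal := by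
      rw [← measureReal_biUnion_finset]
      · refine (measureReal_mono ?_).trans (base A h0)
        intro ω hω
        simp only [Set.mem_iUnion] at hω
        obtain ⟨S, hS, hω⟩ := hω
        rw [hI, Finset.mem_filter] at hS
        have hω : expl A ω = S := hω
        rintro ⟨v, hv, j, hj, H⟩
        obtain rfl : j = 0 := by omega
        apply hS.2
        rw [← hω]
        exact outer_sub ⟨v, hv, H.symm⟩
      · intro S _ S' _ hne
        refine Set.disjoint_left.2 fun ω h1 h2 => hne ?_
        exact Eq.trans (Eq.symm h1) h2
      · intro S _
        exact dep_measurable (dep_expl A S)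
    calc P.real (Hit A (k + 1))ᶜ
        ≤ P.real (⋃ S ∈ I, ({ω | expl A ω = S} ∩ (Hit (A \ S) k)ᶜ)) :=
          measureReal_mono hsub (measure_ne_top _ _)
      _ ≤ ∑ S ∈ I, P.real ({ω | expl A ω = S} ∩ (Hit (A \ S) k)ᶜ) :=
          measureReal_biUnion_finset_le _ _
      _ ≤ ∑ S ∈ I, P.real {ω | expl A ω = S} * (1 - (theta P).toReal) ^ (k + 1) := by
          refine Finset.sum_le_sum fun S hS => ?_
          rw [real_indep hp hP (dep_expl A S) (dep_hit_compl (A \ S) k) Finset.disjoint_sdiff]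
          refine mul_le_mul_of_nonneg_left (ih _ ?_) measureReal_nonneg
          rw [hI, Finset.mem_filter] at hS
          exact Finset.mem_sdiff.2 ⟨h0, hS.2⟩
      _ = (∑ S ∈ I, P.real {ω | expl A ω = S}) * (1 - (theta P).toReal) ^ (k + 1) := by
          rw [Finset.sum_mul]
      _ ≤ (1 - (theta P).toReal) * (1 - (theta P).toReal) ^ (k + 1) :=
          mul_le_mul_of_nonneg_right hsum (pow_nonneg hq _)
      _ = (1 - (theta P).toReal) ^ (k + 1 + 1) := by ring

/-! ### Quarter faces -/

/-- The displacement `d` lies in the quarter face of radius `r` with direction `i`, signs `e`. -/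
def InQ (r : ℕ) (i : Fin 3) (e : Fin 3 → Bool) (d : Site) : Prop :=
  d i = (if e i then (r : ℤ) else -r) ∧
    ∀ j, if e j then 0 ≤ d j ∧ d j ≤ (r : ℤ) else d j ≤ 0 ∧ -(r : ℤ) ≤ d j

/-- The origin reaches a quarter face inside the box at cost at most `k`. -/
def Ev (r k : ℕ) (i : Fin 3) (e : Fin 3 → Bool) : Set Config :=
  {ω | ∃ v, InQ r i e v ∧ RL (box r) ω k 0 v}

/-- The box as a finset. -/
def Bx (r : ℕ) : Finset Site := Fintype.piFinset fun _ => Finset.Icc (-(r : ℤ)) r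

lemma mem_Bx {r : ℕ} {x : Site} : x ∈ Bx r ↔ x ∈ box r := by
  rw [mem_box_iff]
  simp [Bx, abs_le]

lemma coe_Bx (r : ℕ) : (Bx r : Set Site) = box r := by
  ext x
  exact mem_Bx

lemma card_Bx (r : ℕ) : (Bx r).card = (2 * r + 1) ^ 3 := by
  unfold Bx
  rw [Fintype.card_piFinset]
  simp
  omega

lemma dep_ev (r k : ℕ) (i : Fin 3) (e : Fin 3 → Bool) : Dep (Ev r k i e)ᶜ (Bx r) := by
  rintro ω ω' h hω ⟨v, hv, H⟩
  exact hω ⟨v, hv, H.congr fun z hz => (h z (mem_Bx.2 hz)).symm⟩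

lemma decr_ev (r k : ℕ) (i : Fin 3) (e : Fin 3 → Bool) : Decr (Ev r k i e)ᶜ := by
  rintro ω ω' h hω ⟨v, hv, H⟩
  refine hω ⟨v, hv, H.map id (fun _ _ h => h) (fun _ h => h) ?_⟩
  intro x _
  cases hx : ω' x
  · exact Or.inr rfl
  · exact Or.inl (h x hx)

lemma adj_le {x y : Site} (h : Adj x y) (i : Fin 3) : |x i - y i| ≤ 1 := by
  unfold Adj at h
  rw [← h]
  exact Finset.single_le_sum (f := fun i => |x i - y i|) (fun i _ => abs_nonneg _)
    (Finset.mem_univ i)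

lemma ev_inter_sub {r k : ℕ} (hr : 1 ≤ r) :
    (⋂ a ∈ (Finset.univ : Finset (Fin 3 × (Fin 3 → Bool))), (Ev r k a.1 a.2)ᶜ) ⊆
      (Hit (Bx r) k)ᶜ := by
  rintro ω hω ⟨v, ⟨hv, y, hy, hvy⟩, H⟩
  rw [coe_Bx] at hv hy H
  simp only [Set.mem_iInter] at hω
  rw [mem_box_iff] at hv hy
  push Not at hy
  obtain ⟨i, hi⟩ := hy
  refine hω (i, fun j => decide (0 ≤ v j)) (Finset.mem_univ _) ⟨v, ⟨?_, ?_⟩, H⟩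
  · have h1 := adj_le hvy i
    have h2 := hv i
    rw [abs_le] at h1 h2
    rw [lt_abs] at hi
    by_cases h0 : 0 ≤ v i
    · simp only [h0, decide_true, if_true]
      omega
    · simp only [h0, decide_false]
      simp
      omega
  · intro j
    have h2 := hv j
    rw [abs_le] at h2
    by_cases h0 : 0 ≤ v j
    · simp only [h0, decide_true, if_true]
      exact ⟨trivial, h2.2⟩
    · simp only [h0, decide_false]
      simp
      omega

/-- A signed permutation of the coordinates. -/
def sgnPerm (e : Fin 3 → Bool) (τ : Equiv.Perm (Fin 3)) (v : Site) : Site :=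
  fun j => if e j then v (τ j) else - v (τ j)

lemma sgnPerm_adj (e : Fin 3 → Bool) (τ : Equiv.Perm (Fin 3)) (x y : Site) (h : Adj x y) :
    Adj (sgnPerm e τ x) (sgnPerm e τ y) := by
  unfold Adj at *
  rw [← h, ← Equiv.sum_comp τ (fun i => |x i - y i|)]
  refine Finset.sum_congr rfl fun j _ => ?_
  unfold sgnPerm
  split_ifs
  · rfl
  · rw [← abs_neg]
    congr 1
    ring

lemma sgnPerm_box (e : Fin 3 → Bool) (τ : Equiv.Perm (Fin 3)) (r : ℕ) (x : Site)
    (h : x ∈ box r) : sgnPerm e τ x ∈ box r := by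
  rw [mem_box_iff] at *
  intro j
  unfold sgnPerm
  split_ifs
  · exact h _
  · rw [abs_neg]
    exact h _

lemma sgnPerm_inv (e : Fin 3 → Bool) (i : Fin 3) (v : Site) :
    sgnPerm e (Equiv.swap 0 i) (sgnPerm (fun j => e (Equiv.swap 0 i j)) (Equiv.swap 0 i) v) = v := by
  funext j
  unfold sgnPerm
  simp only [Equiv.swap_apply_self]
  split_ifs <;> simp

lemma sgnPerm_inv' (e : Fin 3 → Bool) (i : Fin 3) (v : Site) :
    sgnPerm (fun j => e (Equiv.swap 0 i j)) (Equiv.swap 0 i) (sgnPerm e (Equiv.swap 0 i) v) = v := by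
  have := sgnPerm_inv (fun j => e (Equiv.swap 0 i j)) i v
  simpa using this

lemma sgnPerm_zero (e : Fin 3 → Bool) (τ : Equiv.Perm (Fin 3)) : sgnPerm e τ 0 = 0 := by
  funext j
  simp [sgnPerm]

/-- The signed permutation as an equivalence. -/
def sgnEquiv (e : Fin 3 → Bool) (i : Fin 3) : Site ≃ Site where
  toFun := sgnPerm e (Equiv.swap 0 i)
  invFun := sgnPerm (fun j => e (Equiv.swap 0 i j)) (Equiv.swap 0 i)
  left_inv := sgnPerm_inv' e i
  right_inv := sgnPerm_inv e i

lemma real_ev_eq {p : ℝ} (hp : p ∈ Set.Icc (0 : ℝ) 1) {P : Measure Config}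
    [IsProbabilityMeasure P] (hP : IsBernoulli p P) (r k : ℕ) (i : Fin 3) (e : Fin 3 → Bool) :
    P.real (Ev r k i e)ᶜ = P.real (Ev r k 0 (fun _ => true))ᶜ := by
  rw [← real_equiv hp hP (sgnEquiv e i) (dep_ev r k 0 (fun _ => true))]
  congr 1
  ext ω
  show ¬ (ω ∈ Ev r k i e) ↔ ¬ ((fun z => ω (sgnEquiv e i z)) ∈ Ev r k 0 (fun _ => true))
  rw [not_iff_not]
  constructor
  · rintro ⟨v, ⟨h1, h2⟩, H⟩
    refine ⟨sgnPerm (fun j => e (Equiv.swap 0 i j)) (Equiv.swap 0 i) v, ⟨?_, ?_⟩, ?_⟩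
    · simp only [sgnPerm, Equiv.swap_apply_left, if_true]
      cases he : e i <;> simp [he] at h1 ⊢ <;> omega
    · intro j
      have h3 := h2 (Equiv.swap 0 i j)
      simp only [sgnPerm, if_true]
      split_ifs at h3 ⊢ <;> omega
    · have := H.map (ω' := fun z => ω (sgnEquiv e i z))
        (sgnPerm (fun j => e (Equiv.swap 0 i j)) (Equiv.swap 0 i)) (sgnPerm_adj _ _)
        (sgnPerm_box _ _ r) (by
          intro x _
          show ω (sgnPerm _ _ _) = true ∨ _
          rw [sgnPerm_inv]
          cases ω x <;> simp)
      rwa [sgnPerm_zero] at this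
  · rintro ⟨v, ⟨h1, h2⟩, H⟩
    refine ⟨sgnPerm e (Equiv.swap 0 i) v, ⟨?_, ?_⟩, ?_⟩
    · simp only [sgnPerm, Equiv.swap_apply_right]
      simp only [if_true] at h1
      rw [h1]
    · intro j
      have h3 := h2 (Equiv.swap 0 i j)
      simp only [if_true] at h3
      simp only [sgnPerm]
      cases he : e j <;> simp <;> omega
    · have := H.map (ω' := ω)
        (sgnPerm e (Equiv.swap 0 i)) (sgnPerm_adj _ _)
        (sgnPerm_box _ _ r) (by
          intro x _
          show _ ∨ ω (sgnPerm _ _ _) = false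
          cases ω (sgnPerm e (Equiv.swap 0 i) x) <;> simp)
      rwa [sgnPerm_zero] at this

lemma ev_bound {p : ℝ} (hp : p ∈ Set.Icc (0 : ℝ) 1) {P : Measure Config}
    [IsProbabilityMeasure P] (hP : IsBernoulli p P) {r k : ℕ} (hr : 1 ≤ r) (i : Fin 3)
    (e : Fin 3 → Bool) :
    P.real (Ev r k i e)ᶜ ^ 24 ≤ (1 - (theta P).toReal) ^ (k + 1) := by
  have h1 := real_fkg_prod hp hP (Finset.univ : Finset (Fin 3 × (Fin 3 → Bool)))
    (fun a => (Ev r k a.1 a.2)ᶜ) (fun a => dep_ev r k a.1 a.2) (fun a => decr_ev r k a.1 a.2)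
  have h2 : ∏ a ∈ (Finset.univ : Finset (Fin 3 × (Fin 3 → Bool))), P.real (Ev r k a.1 a.2)ᶜ =
      P.real (Ev r k i e)ᶜ ^ 24 := by
    rw [Finset.prod_congr rfl fun a _ => (real_ev_eq hp hP r k a.1 a.2).trans
      (real_ev_eq hp hP r k i e).symm, Finset.prod_const]
    congr 1
  rw [← h2]
  refine h1.trans ((measureReal_mono (ev_inter_sub hr)).trans (hit_bound hp hP k _ ?_))
  rw [mem_Bx, mem_box_iff]
  intro j
  simp

/-! ### Translation and union bound -/

/-- The bad event at `x`. -/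
def Bad (n k : ℕ) (x : Site) (r : ℕ) (i : Fin 3) (e : Fin 3 → Bool) : Set Config :=
  {ω | ¬ ∃ v : Site, InQ r i e (fun j => v j - x j) ∧ RL (box n) ω k x v}

lemma bad_bound {p : ℝ} (hp : p ∈ Set.Icc (0 : ℝ) 1) {P : Measure Config}
    [IsProbabilityMeasure P] (hP : IsBernoulli p P) (n k : ℕ) (x : Site) (r : ℕ) (i : Fin 3)
    (e : Fin 3 → Bool) (hx : ∀ j, |x j| + r ≤ (n : ℤ)) :
    P.real (Bad n k x r i e) ≤ P.real (Ev r k i e)ᶜ := by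
  rw [← real_equiv hp hP (Equiv.addRight x) (dep_ev r k i e)]
  refine measureReal_mono ?_
  rintro ω hω ⟨v, hv, H⟩
  refine hω ⟨v + x, ?_, ?_⟩
  · have : (fun j => (v + x) j - x j) = v := by
      funext j
      simp
    rw [this]
    exact hv
  · have := H.map (ω' := ω) (B := box n) (fun z => z + x) (by
        intro a b hab
        unfold Adj at *
        rw [← hab]
        refine Finset.sum_congr rfl fun j _ => ?_
        congr 1
        simp) (by
        intro z hz
        rw [mem_box_iff] at *
        intro j
        have h1 := hz j
        have h2 := hx j
        have h3 := abs_add_le (z j) (x j)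
        show |z j + x j| ≤ (n : ℤ)
        omega) (by
        intro z _
        show _ ∨ ω (z + x) = false
        cases ω (z + x) <;> simp)
    simpa using this

lemma good_compl_bound {p : ℝ} (hp : p ∈ Set.Icc (0 : ℝ) 1) {P : Measure Config}
    [IsProbabilityMeasure P] (hP : IsBernoulli p P) (n k : ℕ) {b : ℝ} (hb : 0 ≤ b)
    (hqb : (1 - (theta P).toReal) ^ (k + 1) ≤ b ^ 24) :
    P.real {ω | ¬ Good n k ω} ≤ (2 * n + 1) ^ 3 * n * 24 * b := by
  classical
  set I : Finset (Site × ℕ × Fin 3 × (Fin 3 → Bool)) :=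
    ((Bx n) ×ˢ (Finset.Icc 1 n) ×ˢ Finset.univ).filter
      fun a => ∀ j, |a.1 j| + a.2.1 ≤ (n : ℤ) with hI
  have hcard : (I.card : ℝ) ≤ (2 * n + 1) ^ 3 * n * 24 := by
    have h1 : I.card ≤ (2 * n + 1) ^ 3 * (n * 24) := by
      refine (Finset.card_filter_le _ _).trans ?_
      rw [Finset.card_product, Finset.card_product, card_Bx]
      simp
    have h2 : (I.card : ℝ) ≤ (((2 * n + 1) ^ 3 * (n * 24) : ℕ) : ℝ) := by exact_mod_cast h1
    refine h2.trans (le_of_eq ?_)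
    push_cast
    ring
  have hsub : {ω | ¬ Good n k ω} ⊆ ⋃ a ∈ I, Bad n k a.1 a.2.1 a.2.2.1 a.2.2.2 := by
    intro ω hω
    by_contra hc
    apply hω
    intro x r hr hrn hx i e
    by_contra hne
    apply hc
    simp only [Set.mem_iUnion]
    lift r to ℕ using by omega
    refine ⟨(x, r, i, e), ?_, ?_⟩
    · rw [hI, Finset.mem_filter]
      refine ⟨?_, hx⟩
      simp only [Finset.mem_product, Finset.mem_univ, and_true, Finset.mem_Icc]
      refine ⟨?_, by omega, by omega⟩
      rw [mem_Bx, mem_box_iff]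
      intro j
      have := hx j
      omega
    · rintro ⟨v, hv, H⟩
      exact hne ⟨v, hv.1, hv.2, H⟩
  calc P.real {ω | ¬ Good n k ω} ≤ P.real (⋃ a ∈ I, Bad n k a.1 a.2.1 a.2.2.1 a.2.2.2) :=
        measureReal_mono hsub (measure_ne_top _ _)
    _ ≤ ∑ a ∈ I, P.real (Bad n k a.1 a.2.1 a.2.2.1 a.2.2.2) := measureReal_biUnion_finset_le _ _
    _ ≤ ∑ a ∈ I, b := by
        refine Finset.sum_le_sum fun a ha => ?_
        rw [hI, Finset.mem_filter] at ha
        simp only [Finset.mem_product, Finset.mem_univ, and_true, Finset.mem_Icc] at ha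
        refine (bad_bound hp hP n k a.1 a.2.1 a.2.2.1 a.2.2.2 ha.2).trans ?_
        have := (ev_bound hp hP (k := k) ha.1.2.1 a.2.2.1 a.2.2.2).trans hqb
        exact le_of_pow_le_pow_left₀ (by norm_num) hb this
    _ = I.card * b := by rw [Finset.sum_const, nsmul_eq_mul]
    _ ≤ (2 * n + 1) ^ 3 * n * 24 * b := mul_le_mul_of_nonneg_right hcard hb


/-- **Theorem (travel time in a finite box).**  If `θ(p) > 0` and `α > 0`, then there is a
constant `κ > 0` such that for every `n ≥ 2`, with probability at least `1 - 1/n^α`, every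
pair of vertices of `Λ(n)` are joined by a path in `Λ(n)` having at most `κ (ln n)²`
closed sites. -/
theorem stmt_0 (p : ℝ) (hp : p ∈ Set.Icc (0 : ℝ) 1)
    (P : Measure Config) [IsProbabilityMeasure P] (hP : IsBernoulli p P)
    (hθ : 0 < theta P) (α : ℝ) (hα : 0 < α) :
    ∃ κ : ℝ, 0 < κ ∧ ∀ n : ℕ, 2 ≤ n →
      1 - 1 / (n : ℝ≥0∞) ^ α ≤
        P {ω | ∀ x ∈ box n, ∀ y ∈ box n,
          travelTime ω (box n) x y ≤ ENNReal.ofReal (κ * Real.log n ^ 2)} := by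
  classical
  have hq1 : 1 - (theta P).toReal < 1 := by
    have : 0 < (theta P).toReal := ENNReal.toReal_pos hθ.ne' (measure_ne_top _ _)
    linarith
  have hq0 : 0 ≤ 1 - (theta P).toReal := by
    have : (theta P).toReal ≤ 1 := measureReal_le_one
    linarith
  obtain ⟨q, hqq, hqpos, hqlt⟩ : ∃ q : ℝ, 1 - (theta P).toReal ≤ q ∧ 0 < q ∧ q < 1 :=
    ⟨max (1 - (theta P).toReal) (1 / 2), le_max_left _ _,
      lt_of_lt_of_le (by norm_num) (le_max_right _ _), max_lt hq1 (by norm_num)⟩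
  have hlq : Real.log q < 0 := Real.log_neg hqpos hqlt
  set C : ℝ := 24 * (α + 14) / (-Real.log q) + 2 with hC
  have hC2 : 2 ≤ C := by
    have : 0 ≤ 24 * (α + 14) / (-Real.log q) := by
      apply div_nonneg <;> linarith
    linarith
  have hCq : C * Real.log q ≤ -(24 * (α + 14)) := by
    have h1 : 24 * (α + 14) / (-Real.log q) * Real.log q = -(24 * (α + 14)) := by
      have hne : -Real.log q ≠ 0 := neg_ne_zero.2 hlq.ne
      have h2 := div_mul_cancel₀ (24 * (α + 14)) hne
      linarith
    rw [hC, add_mul, h1]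
    linarith
  refine ⟨48 * C + 96, by linarith, fun n hn => ?_⟩
  have hn0 : (0 : ℝ) < n := by
    have : 0 < n := by omega
    exact_mod_cast this
  have hn2 : (2 : ℝ) ≤ n := by exact_mod_cast hn
  have hl2 : (1 / 2 : ℝ) < Real.log 2 := by
    have := Real.log_two_gt_d9
    linarith
  set L := Real.log n with hL
  have hLl : Real.log 2 ≤ L := Real.log_le_log (by norm_num) hn2
  have hL2 : 1 / 2 < L := by linarith
  set k := ⌊C * L⌋₊ with hk
  have hk1 : 1 ≤ k := Nat.le_floor (by push_cast; nlinarith)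
  have hkle : (k : ℝ) ≤ C * L := Nat.floor_le (by nlinarith)
  have hklt : C * L < k + 1 := Nat.lt_floor_add_one _
  set s := Nat.log 2 n + 1 with hs
  have hns : n ≤ 2 ^ s := (Nat.lt_pow_succ_log_self (by norm_num) n).le
  have hsL : (s : ℝ) ≤ 4 * L := by
    have h1 : (2 : ℝ) ^ Nat.log 2 n ≤ n := by exact_mod_cast Nat.pow_log_le_self 2 (by omega)
    have h2 := Real.log_le_log (by positivity) h1
    rw [Real.log_pow] at h2
    have h3 : (0 : ℝ) ≤ (Nat.log 2 n : ℝ) := by positivity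
    rw [hs]
    push_cast
    nlinarith
  set b : ℝ := (n : ℝ) ^ (-(α + 14)) with hb
  have hb0 : 0 ≤ b := by positivity
  have hqb : (1 - (theta P).toReal) ^ (k + 1) ≤ b ^ 24 := by
    refine (pow_le_pow_left₀ hq0 hqq _).trans ?_
    have h1 : q ^ (k + 1) = Real.exp (Real.log q * ((k + 1 : ℕ) : ℝ)) := by
      rw [mul_comm, Real.exp_nat_mul, Real.exp_log hqpos]
    have h2 : b ^ 24 = Real.exp (L * (-(α + 14)) * 24) := by
      rw [hb, Real.rpow_def_of_pos hn0, ← Real.exp_nat_mul]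
      congr 1
      push_cast
      ring
    rw [h1, h2, Real.exp_le_exp]
    push_cast
    nlinarith
  have hgb := good_compl_bound hp hP n k hb0 hqb
  have hfin : P.real {ω | ¬ Good n k ω} ≤ (n : ℝ) ^ (-α) := by
    refine hgb.trans ?_
    have h1 : b = (n : ℝ) ^ (-α) * ((n : ℝ) ^ 14)⁻¹ := by
      rw [hb, neg_add, Real.rpow_add hn0, Real.rpow_neg hn0.le 14]
      congr 2
      exact_mod_cast Real.rpow_natCast (n : ℝ) 14
    have h2 : (2 * (n : ℝ) + 1) ^ 3 * n * 24 ≤ (n : ℝ) ^ 14 := by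
      have h3 : (2 * (n : ℝ) + 1) ^ 3 ≤ (3 * n) ^ 3 :=
        pow_le_pow_left₀ (by positivity) (by linarith) 3
      have h4 : (2 : ℝ) ^ 10 ≤ (n : ℝ) ^ 10 := pow_le_pow_left₀ (by norm_num) hn2 10
      calc (2 * (n : ℝ) + 1) ^ 3 * n * 24 ≤ (3 * n) ^ 3 * n * 24 := by gcongr
        _ = 648 * (n : ℝ) ^ 4 := by ring
        _ ≤ (n : ℝ) ^ 10 * (n : ℝ) ^ 4 := by
            refine mul_le_mul_of_nonneg_right ?_ (by positivity)
            linarith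
        _ = (n : ℝ) ^ 14 := by ring
    have h5 : (0 : ℝ) < (n : ℝ) ^ 14 := by positivity
    have h6 : (0 : ℝ) ≤ (n : ℝ) ^ (-α) := by positivity
    rw [h1]
    calc (2 * (n : ℝ) + 1) ^ 3 * n * 24 * ((n : ℝ) ^ (-α) * ((n : ℝ) ^ 14)⁻¹)
        ≤ (n : ℝ) ^ 14 * ((n : ℝ) ^ (-α) * ((n : ℝ) ^ 14)⁻¹) :=
          mul_le_mul_of_nonneg_right h2 (by positivity)
      _ = (n : ℝ) ^ (-α) := by field_simp
  have hfin' : P {ω | ¬ Good n k ω} ≤ 1 / (n : ℝ≥0∞) ^ α := by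
    have h1 : P {ω | ¬ Good n k ω} = ENNReal.ofReal (P.real {ω | ¬ Good n k ω}) :=
      (ENNReal.ofReal_toReal (measure_ne_top _ _)).symm
    rw [h1]
    refine (ENNReal.ofReal_le_ofReal hfin).trans (le_of_eq ?_)
    rw [← ENNReal.ofReal_rpow_of_pos hn0, ENNReal.ofReal_natCast, ENNReal.rpow_neg, one_div]
  have hsub : {ω | Good n k ω} ⊆ {ω | ∀ x ∈ box n, ∀ y ∈ box n,
      travelTime ω (box n) x y ≤ ENNReal.ofReal ((48 * C + 96) * L ^ 2)} := by
    intro ω hω x hx y hy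
    refine (route_all hn hω hk1 s hns x y hx hy).trans ?_
    rw [← ENNReal.ofReal_natCast]
    refine ENNReal.ofReal_le_ofReal ?_
    push_cast
    have h1 : (k : ℝ) * s ≤ C * L * (4 * L) :=
      mul_le_mul hkle hsL (by positivity) (by nlinarith)
    nlinarith
  rw [tsub_le_iff_right]
  calc (1 : ℝ≥0∞) = P ({ω | Good n k ω} ∪ {ω | ¬ Good n k ω}) := by
        have : {ω | Good n k ω} ∪ {ω | ¬ Good n k ω} = Set.univ := by
          ext ω
          simp [em]
        rw [this, measure_univ]
    _ ≤ P {ω | Good n k ω} + P {ω | ¬ Good n k ω} := measure_union_le _ _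
    _ ≤ _ := add_le_add (measure_mono hsub) hfin'
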